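/- Let T > 0, q > 2 and K₁ > 0, and suppose f : [0,T] × ℝ^d → ℝ^d and g : [0,T] × ℝ^d → ℝ^{d×m} satisfy ⟨x, f(t,x)⟩ + ((5q−1)/2)|g(t,x)|² ≤ K₁(1 + |x|²) for all t ∈ [0,T] and all x ∈ ℝ^d. Then for every R > 0, every t ∈ [0,T] and every x ∈ ℝ^d, ⟨x, f(t, π_R(x))⟩ + ((5q−1)/2)|g(t, π_R(x))|² ≤ 2K₁·max(1, 1/R)·(1 + |x|²). -/

import Mathlib

/-- The truncation mapping `π_R(x) = (min(|x|, R)/|x|) • x` (with `π_R 0 = 0`). -/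
noncomputable def truncMap {d : ℕ} (R : ℝ) (x : EuclideanSpace ℝ (Fin d)) :
    EuclideanSpace ℝ (Fin d) :=
  (min ‖x‖ R / ‖x‖) • x

/-- the truncated coefficients inherit the Khasminskii-type condition. -/
theorem stmt_2 (T q K₁ : ℝ) (hT : 0 < T) (hq : 2 < q) (hK₁ : 0 < K₁) (d m : ℕ)
    (f : ℝ → EuclideanSpace ℝ (Fin d) → EuclideanSpace ℝ (Fin d))
    (g : ℝ → EuclideanSpace ℝ (Fin d) → EuclideanSpace ℝ (Fin d × Fin m))
    (h : ∀ t ∈ Set.Icc (0 : ℝ) T, ∀ x : EuclideanSpace ℝ (Fin d),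
      (inner ℝ x (f t x) : ℝ) + ((5 * q - 1) / 2) * ‖g t x‖ ^ 2 ≤ K₁ * (1 + ‖x‖ ^ 2)) :
    ∀ R : ℝ, 0 < R → ∀ t ∈ Set.Icc (0 : ℝ) T, ∀ x : EuclideanSpace ℝ (Fin d),
      (inner ℝ x (f t (truncMap R x)) : ℝ) + ((5 * q - 1) / 2) * ‖g t (truncMap R x)‖ ^ 2 ≤
        2 * K₁ * max 1 (1 / R) * (1 + ‖x‖ ^ 2) := by
  intro R hR t ht x
  have hM1 : (1 : ℝ) ≤ max 1 (1 / R) := le_max_left _ _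
  have hM2 : 1 / R ≤ max 1 (1 / R) := le_max_right _ _
  generalize max 1 (1 / R) = M at hM1 hM2
  have hn : 0 ≤ ‖x‖ := norm_nonneg x
  by_cases hx : ‖x‖ ≤ R
  · have e : truncMap R x = x := by
      unfold truncMap
      rw [min_eq_left hx]
      by_cases h0 : x = 0
      · simp [h0]
      · rw [div_self (norm_ne_zero_iff.mpr h0), one_smul]
    rw [e]
    refine (h t ht x).trans ?_
    have : 0 ≤ K₁ * (1 + ‖x‖ ^ 2) := by positivity
    nlinarith
  · push Not at hx
    have hpos : 0 < ‖x‖ := hR.trans hx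
    have e : truncMap R x = (R / ‖x‖) • x := by
      unfold truncMap
      rw [min_eq_right hx.le]
    have hy := h t ht (truncMap R x)
    have hny : ‖truncMap R x‖ = R := by
      rw [e, norm_smul, Real.norm_eq_abs, abs_of_pos (by positivity)]
      field_simp
    have hxy : x = (‖x‖ / R) • truncMap R x := by
      rw [e, smul_smul]
      have : ‖x‖ / R * (R / ‖x‖) = 1 := by field_simp
      rw [this, one_smul]
    have hin : (inner ℝ x (f t (truncMap R x)) : ℝ)
        = (‖x‖ / R) * inner ℝ (truncMap R x) (f t (truncMap R x)) := by
      rw [← real_inner_smul_left, ← hxy]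
    rw [hny] at hy
    rw [hin]
    have hG : 0 ≤ ((5 * q - 1) / 2) * ‖g t (truncMap R x)‖ ^ 2 :=
      mul_nonneg (by linarith) (sq_nonneg _)
    generalize ((5 * q - 1) / 2) * ‖g t (truncMap R x)‖ ^ 2 = G at hy hG
    generalize (inner ℝ (truncMap R x) (f t (truncMap R x)) : ℝ) = I at hy
    have hr : 1 ≤ ‖x‖ / R := (one_le_div hR).mpr hx.le
    have h1 := mul_le_mul_of_nonneg_left hy (zero_le_one.trans hr)
    have h2 : G ≤ ‖x‖ / R * G := le_mul_of_one_le_left hG hr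
    have h3 : ‖x‖ / R * (K₁ * (1 + R ^ 2)) = K₁ * (‖x‖ * (1 / R) + ‖x‖ * R) := by
      field_simp
    have h4 : ‖x‖ * (1 / R) ≤ ‖x‖ * M := mul_le_mul_of_nonneg_left hM2 hn
    have h5 : ‖x‖ * R ≤ ‖x‖ * ‖x‖ := mul_le_mul_of_nonneg_left hx.le hn
    have h6 : ‖x‖ * M ≤ (1 + ‖x‖ ^ 2) * M :=
      mul_le_mul_of_nonneg_right (by nlinarith [sq_nonneg (‖x‖ - 1)]) (by linarith)
    have h7 : ‖x‖ * ‖x‖ ≤ (1 + ‖x‖ ^ 2) * M := by nlinarith [sq_nonneg ‖x‖]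
    have h8 : K₁ * (‖x‖ * (1 / R) + ‖x‖ * R) ≤ K₁ * (2 * ((1 + ‖x‖ ^ 2) * M)) :=
      mul_le_mul_of_nonneg_left (by linarith) hK₁.le
    nlinarith
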